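/- Let f ∈ Homeo¹(ℝ²). Let α and β be simple closed C¹ curves in ℝ² and let p ∈ α ∩ β. If α and β have the same tangent line at p, then f(α) and f(β) have the same tangent line at f(p). -/

import Mathlib

open Filter Topology

noncomputable section

abbrev Plane : Type := ℝ × ℝ

abbrev ProjLine : Type := Projectivization ℝ Plane

instance : TopologicalSpace ProjLine := instTopologicalSpaceQuotient

/-- A regular (C¹, 1-periodic, injective on `[0,1)`, nowhere-vanishing derivative)
parameterization of a simple closed C¹ curve. -/
def IsRegParam (γ : ℝ → Plane) : Prop :=
  ContDiff ℝ 1 γ ∧ Function.Periodic γ 1 ∧ Set.InjOn γ (Set.Ico 0 1) ∧ ∀ t, deriv γ t ≠ 0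

/-- `Γ` is a simple closed C¹ curve. -/
def IsC1Curve (Γ : Set Plane) : Prop := ∃ γ : ℝ → Plane, IsRegParam γ ∧ Γ = Set.range γ

/-- `Γ` is a simple closed C¹ curve through `p` with tangent line `ℓ` at `p`. -/
def TangentAt (Γ : Set Plane) (p : Plane) (ℓ : ProjLine) : Prop :=
  ∃ (γ : ℝ → Plane) (t₀ : ℝ) (h : IsRegParam γ),
    Γ = Set.range γ ∧ γ t₀ = p ∧ ℓ = Projectivization.mk ℝ (deriv γ t₀) (h.2.2.2 t₀)

/-- `f` maps every simple closed C¹ curve to a simple closed C¹ curve. -/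
def MapsC1 (f : Plane → Plane) : Prop := ∀ Γ : Set Plane, IsC1Curve Γ → IsC1Curve (f '' Γ)

/-- Membership in `Homeo¹(ℝ²)`. -/
def InHomeo1 (f : Plane ≃ₜ Plane) : Prop := MapsC1 ⇑f ∧ MapsC1 ⇑f.symm

/-- `φ` is a homeomorphism of projective tangent spaces induced by `f` at `p`. -/
def InducesAt (f : Plane → Plane) (p : Plane) (φ : ProjLine ≃ₜ ProjLine) : Prop :=
  ∀ (Γ : Set Plane) (ℓ : ProjLine), TangentAt Γ p ℓ →
    IsC1Curve (f '' Γ) ∧ TangentAt (f '' Γ) (f p) (φ ℓ)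

/-- The secant direction from `q` to `x` (junk value if `x = q`). -/
def secantDir (q x : Plane) : ProjLine :=
  if h : x = q then Projectivization.mk ℝ (1, 0) (by simp) else
    Projectivization.mk ℝ (x - q) (sub_ne_zero.mpr h)

/-- The sequence `x` converges along the line `ℓ` to `p`. -/
def ConvAlong (p : Plane) (ℓ : ProjLine) (x : ℕ → Plane) : Prop :=
  (∀ n, x n ≠ p) ∧ Tendsto x atTop (𝓝 p) ∧
    Tendsto (fun n => secantDir p (x n)) atTop (𝓝 ℓ)

/-- `(x, k)` is a transverse sequence for `(p, ℓ)`. -/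
def TransverseFor (p : Plane) (ℓ : ProjLine) (x : ℕ → Plane) (k : ℕ → ProjLine) : Prop :=
  ConvAlong p ℓ x ∧
    ∀ φ : ℕ → ℕ, StrictMono φ →
      ¬ Tendsto (fun n => (x (φ n), k (φ n))) atTop (𝓝 (p, ℓ))

/-- `(x, k)` is a transverse sequence. -/
def Transverse (x : ℕ → Plane) (k : ℕ → ProjLine) : Prop := ∃ p ℓ, TransverseFor p ℓ x k

/-- The determinant of two vectors of the plane. -/
def planeDet (v w : Plane) : ℝ := v.1 * w.2 - v.2 * w.1

theorem mk_eq_mk_of_planeDet_eq_zero {v w : Plane} (hv : v ≠ 0) (hw : w ≠ 0)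
    (h : planeDet v w = 0) : Projectivization.mk ℝ v hv = Projectivization.mk ℝ w hw := by
  rw [Projectivization.mk_eq_mk_iff']
  obtain ⟨a, b⟩ := v
  obtain ⟨c, d⟩ := w
  simp only [planeDet] at h
  by_cases hc : c = 0
  · subst hc
    have hd : d ≠ 0 := fun hd => hw (by simp [hd])
    have ha : a = 0 := by simpa [hd] using h
    exact ⟨b / d, by ext <;> simp [ha, hd]⟩
  · refine ⟨a / c, ?_⟩
    ext
    · simp [hc]
    · simp only [Prod.smul_mk, smul_eq_mul]
      field_simp
      linarith

namespace IsRegParam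

variable {γ η : ℝ → Plane}

theorem exists_int_of_eq (hγ : IsRegParam γ) {a b : ℝ} (h : γ a = γ b) :
    ∃ z : ℤ, a - b = z := by
  rw [← Int.fract_eq_fract]
  have key : ∀ x, γ (Int.fract x) = γ x := fun x => by
    have h := hγ.2.1.sub_int_mul_eq ⌊x⌋ (x := x)
    rwa [mul_one] at h
  exact hγ.2.2.1 ⟨Int.fract_nonneg a, Int.fract_lt_one a⟩
    ⟨Int.fract_nonneg b, Int.fract_lt_one b⟩ (by rw [key, key, h])

theorem hasDerivAt (hγ : IsRegParam γ) (t : ℝ) : HasDerivAt γ (deriv γ t) t :=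
  (hγ.1.differentiable one_ne_zero t).hasDerivAt

/-- A sequence on the curve converging to `γ t₀` lifts to parameters converging to `t₀`. -/
theorem exists_lift (hγ : IsRegParam γ) (t₀ : ℝ) {x : ℕ → Plane}
    (hx : Tendsto x atTop (𝓝 (γ t₀))) (hr : ∀ n, x n ∈ Set.range γ) :
    ∃ t : ℕ → ℝ, (∀ n, γ (t n) = x n) ∧ Tendsto t atTop (𝓝 t₀) := by
  have hlift : ∀ n, ∃ t ∈ Set.Ico (t₀ - 1 / 2) (t₀ - 1 / 2 + 1), γ t = x n := fun n => by
    obtain ⟨s, hs⟩ := hr n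
    obtain ⟨t, ht, hst⟩ := hγ.2.1.exists_mem_Ico one_pos s (t₀ - 1 / 2)
    exact ⟨t, ht, by rw [← hst, hs]⟩
  choose t ht hγt using hlift
  have hK : IsCompact (Set.Icc (t₀ - 1 / 2) (t₀ + 1 / 2)) := isCompact_Icc
  refine ⟨t, hγt, hK.tendsto_nhds_of_unique_mapClusterPt
    (Eventually.of_forall fun n => ⟨(ht n).1, by linarith [(ht n).2]⟩) fun y hy hcl => ?_⟩
  have hcl' : MapClusterPt (γ y) atTop x := by
    have := hcl.continuousAt_comp hγ.1.continuous.continuousAt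
    rwa [show γ ∘ t = x from funext hγt] at this
  have hy' : γ y = γ t₀ := by
    by_contra hne
    have hdis := disjoint_nhds_nhds.2 hne
    have : (𝓝 (γ y) ⊓ map x atTop).NeBot := hcl'
    exact this.ne (hdis.mono_right hx).eq_bot
  obtain ⟨z, hz⟩ := hγ.exists_int_of_eq hy'
  have h1 : (z : ℝ) < 1 := by linarith [hy.2]
  have h2 : (-1 : ℝ) < z := by linarith [hy.1]
  have hz0 : z = 0 := by
    have h1' : z < 1 := by exact_mod_cast h1
    have h2' : -1 < z := by exact_mod_cast h2
    omega
  rw [hz0] at hz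
  simp only [Int.cast_zero] at hz
  linarith

theorem exists_tendsto_secant (hγ : IsRegParam γ) (t₀ : ℝ) {x : ℕ → Plane}
    (hx : Tendsto x atTop (𝓝 (γ t₀))) (hne : ∀ n, x n ≠ γ t₀) (hr : ∀ n, x n ∈ Set.range γ) :
    ∃ c : ℕ → ℝ, Tendsto (fun n => c n • (x n - γ t₀)) atTop (𝓝 (deriv γ t₀)) := by
  obtain ⟨t, hγt, ht⟩ := hγ.exists_lift t₀ hx hr
  refine ⟨fun n => (t n - t₀)⁻¹, ?_⟩
  have ht' : Tendsto t atTop (𝓝[≠] t₀) := tendsto_nhdsWithin_iff.2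
    ⟨ht, Eventually.of_forall fun n h => hne n (by rw [← hγt n, show t n = t₀ from h])⟩
  refine ((hasDerivAt_iff_tendsto_slope.1 (hγ.hasDerivAt t₀)).comp ht').congr fun n => ?_
  simp [slope, hγt]

/-- Two curves sharing a sequence of points that accumulates at a common point are tangent
there. -/
theorem mk_deriv_eq (hγ : IsRegParam γ) (hη : IsRegParam η) {t₀ s₀ : ℝ} {q : Plane}
    (ht : γ t₀ = q) (hs : η s₀ = q) {x : ℕ → Plane} (hx : Tendsto x atTop (𝓝 q))
    (hne : ∀ n, x n ≠ q) (hxγ : ∀ n, x n ∈ Set.range γ) (hxη : ∀ n, x n ∈ Set.range η) :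
    Projectivization.mk ℝ (deriv γ t₀) (hγ.2.2.2 t₀) =
      Projectivization.mk ℝ (deriv η s₀) (hη.2.2.2 s₀) := by
  apply mk_eq_mk_of_planeDet_eq_zero
  obtain ⟨c, hc⟩ := hγ.exists_tendsto_secant t₀ (by rwa [ht]) (by rwa [ht]) hxγ
  obtain ⟨d, hd⟩ := hη.exists_tendsto_secant s₀ (by rwa [hs]) (by rwa [hs]) hxη
  rw [ht] at hc
  rw [hs] at hd
  have hcont : Continuous fun z : Plane × Plane => planeDet z.1 z.2 := by
    unfold planeDet; fun_prop
  refine tendsto_nhds_unique ((hcont.tendsto _).comp (hc.prodMk_nhds hd)) ?_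
  refine tendsto_const_nhds.congr fun n => ?_
  simp only [planeDet, Function.comp_apply, Prod.smul_fst, Prod.smul_snd, smul_eq_mul]
  ring

end IsRegParam

theorem hasDerivAt_max_zero_sq (x : ℝ) :
    HasDerivAt (fun y : ℝ => max 0 y ^ 2) (2 * max 0 x) x := by
  rcases lt_trichotomy x 0 with hx | rfl | hx
  · rw [max_eq_left hx.le, mul_zero]
    refine (hasDerivAt_const x (0 : ℝ)).congr_of_eventuallyEq ?_
    filter_upwards [gt_mem_nhds hx] with y hy
    simp [max_eq_left (show y ≤ 0 from le_of_lt hy)]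
  · rw [hasDerivAt_iff_isLittleO_nhds_zero]
    simp only [zero_add, max_self, mul_zero, smul_zero, sub_zero, ne_eq, OfNat.ofNat_ne_zero,
      not_false_eq_true, zero_pow]
    refine Asymptotics.IsBigO.trans_isLittleO (g := fun y : ℝ => y ^ 2) ?_
      (by simpa using Asymptotics.isLittleO_pow_pow (𝕜 := ℝ) (m := 1) (n := 2) one_lt_two)
    refine Asymptotics.IsBigO.of_norm_le fun y => ?_
    rw [Real.norm_of_nonneg (by positivity)]
    rcases le_total y 0 with hy | hy
    · rw [max_eq_left hy, zero_pow two_ne_zero]; exact sq_nonneg y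
    · rw [max_eq_right hy]
  · rw [max_eq_right hx.le]
    have h := hasDerivAt_pow 2 x
    simp only [Nat.cast_ofNat, Nat.add_one_sub_one, pow_one] at h
    refine h.congr_of_eventuallyEq ?_
    filter_upwards [lt_mem_nhds hx] with y hy
    simp [max_eq_right (show 0 ≤ y from le_of_lt hy)]

theorem contDiff_max_zero_sq : ContDiff ℝ 1 (fun y : ℝ => max 0 y ^ 2) := by
  rw [contDiff_one_iff_deriv]
  refine ⟨fun x => (hasDerivAt_max_zero_sq x).differentiableAt, ?_⟩
  rw [show deriv (fun y : ℝ => max 0 y ^ 2) = fun x => 2 * max 0 x from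
    funext fun x => (hasDerivAt_max_zero_sq x).deriv]
  fun_prop

/-- Multiplying a C¹ function that vanishes to first order at `0` by `(1 + sin (log |t|)) / 2`
gives a C¹ function that vanishes to first order at `0`. -/
theorem contDiff_and_hasDerivAt_oscillation {d : ℝ → Plane} (hd : ContDiff ℝ 1 d) (h0 : d 0 = 0)
    (h0' : deriv d 0 = 0) :
    ContDiff ℝ 1 (fun t => ((1 + Real.sin (Real.log t)) / 2) • d t) ∧
      HasDerivAt (fun t => ((1 + Real.sin (Real.log t)) / 2) • d t) 0 0 := by
  have hder : ∀ t, HasDerivAt d (deriv d t) t := fun t =>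
    (hd.differentiable one_ne_zero t).hasDerivAt
  have hs : ∀ t, ‖(1 + Real.sin (Real.log t)) / 2‖ ≤ 1 := fun t => by
    rw [Real.norm_eq_abs, abs_le]
    constructor <;> linarith [Real.sin_le_one (Real.log t), Real.neg_one_le_sin (Real.log t)]
  have hc : ∀ t, ‖Real.cos (Real.log t) / 2‖ ≤ 1 := fun t => by
    rw [Real.norm_eq_abs, abs_le]
    constructor <;> linarith [Real.cos_le_one (Real.log t), Real.neg_one_le_cos (Real.log t)]
  have hslope : Tendsto (fun t => t⁻¹ • d t) (𝓝 0) (𝓝 0) := by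
    rw [← pure_sup_nhdsNE, tendsto_sup]
    refine ⟨tendsto_pure_left.2 fun s hs => by simpa using mem_of_mem_nhds hs, ?_⟩
    have := hasDerivAt_iff_tendsto_slope.1 (hder 0)
    rw [h0'] at this
    refine this.congr fun t => ?_
    simp [slope, h0]
  have mul0 : ∀ {b : ℝ → ℝ} {u : ℝ → Plane} {l : Filter ℝ}, (∀ t, ‖b t‖ ≤ 1) →
      Tendsto u l (𝓝 0) → Tendsto (fun t => b t • u t) l (𝓝 0) := fun {b u l} hb hu => by
    refine squeeze_zero_norm (fun t => ?_) (tendsto_zero_iff_norm_tendsto_zero.1 hu)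
    rw [norm_smul]
    exact mul_le_of_le_one_left (norm_nonneg _) (hb t)
  set D : ℝ → Plane := fun t => ((1 + Real.sin (Real.log t)) / 2) • deriv d t +
    (Real.cos (Real.log t) / 2) • (t⁻¹ • d t) with hD
  have hD0 : D 0 = 0 := by simp [hD, h0']
  have hderD : ∀ t, HasDerivAt (fun t => ((1 + Real.sin (Real.log t)) / 2) • d t) (D t) t := by
    intro t
    rcases eq_or_ne t 0 with rfl | ht
    · rw [hD0, hasDerivAt_iff_tendsto_slope]
      refine (mul0 hs (hslope.mono_left nhdsWithin_le_nhds)).congr fun t => ?_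
      simp [slope, h0, smul_comm (t⁻¹)]
    · refine (((((Real.hasDerivAt_log ht).sin).const_add 1).div_const 2).fun_smul
        (hder t)).congr_deriv ?_
      simp only [hD, smul_smul]
      congr 2
      ring
  refine ⟨?_, hD0 ▸ hderD 0⟩
  rw [contDiff_one_iff_deriv]
  refine ⟨fun t => (hderD t).differentiableAt, ?_⟩
  rw [funext fun t => (hderD t).deriv, continuous_iff_continuousAt]
  have hdc : Continuous (deriv d) := hd.continuous_deriv le_rfl
  intro t
  rcases eq_or_ne t 0 with rfl | ht
  · rw [ContinuousAt, hD0]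
    have h1 := mul0 hs (by simpa [h0'] using hdc.tendsto 0)
    simpa using h1.add (mul0 hc hslope)
  · have hlog : ContinuousAt Real.log t := Real.continuousAt_log ht
    have hdt := hd.continuous.continuousAt (x := t)
    have hdc' := hdc.continuousAt (x := t)
    have hinv := continuousAt_inv₀ ht
    have hsin := Real.continuous_sin.continuousAt.comp hlog
    have hcos := Real.continuous_cos.continuousAt.comp hlog
    exact (((continuousAt_const.add hsin).div_const 2).smul hdc').add
      ((hcos.div_const 2).smul (hinv.smul hdt))

/-- A germ of an immersed C¹ arc is contained in a simple closed C¹ curve. -/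
theorem exists_regParam_through_germ {g : ℝ → Plane} (hg : ContDiff ℝ 1 g) (h0 : deriv g 0 ≠ 0) :
    ∃ γ : ℝ → Plane, IsRegParam γ ∧ γ 0 = g 0 ∧ ∀ᶠ t in 𝓝 0, g t ∈ Set.range γ := by
  set v := deriv g 0 with hv
  set w : Plane := (-v.2, v.1) with hw
  set L : Plane →L[ℝ] ℝ :=
    v.1 • ContinuousLinearMap.fst ℝ ℝ ℝ + v.2 • ContinuousLinearMap.snd ℝ ℝ ℝ with hL
  have hLw : L w = 0 := by simp [hL, hw]; ring
  have hw0 : w ≠ 0 := fun h => h0 (by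
    simp only [hw, Prod.mk_eq_zero, neg_eq_zero] at h
    exact Prod.ext h.2 h.1)
  have hLv : 0 < L v := by
    have : L v = v.1 ^ 2 + v.2 ^ 2 := by simp [hL]; ring
    rw [this]
    by_contra hcon
    exact h0 (Prod.ext (by simp; nlinarith [sq_nonneg v.1, sq_nonneg v.2])
      (by simp; nlinarith [sq_nonneg v.1, sq_nonneg v.2]))
  have hgd : ∀ t, HasDerivAt g (deriv g t) t := fun t =>
    (hg.differentiable one_ne_zero t).hasDerivAt
  have hLg : ∀ t, HasDerivAt (fun t => L (g t)) (L (deriv g t)) t := fun t =>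
    L.hasFDerivAt.comp_hasDerivAt t (hgd t)
  obtain ⟨δ, hδ, hpos⟩ : ∃ δ > 0, ∀ t ∈ Set.Icc (-δ) δ, 0 < L (deriv g t) := by
    have hev : ∀ᶠ t in 𝓝 (0 : ℝ), 0 < L (deriv g t) :=
      (L.continuous.comp (hg.continuous_deriv le_rfl)).continuousAt.eventually (lt_mem_nhds hLv)
    obtain ⟨ε, hε, hball⟩ := Metric.eventually_nhds_iff.1 hev
    refine ⟨ε / 2, by positivity, fun t ht => hball ?_⟩
    rw [Real.dist_eq, sub_zero, abs_lt]
    constructor <;> linarith [ht.1, ht.2]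
  have hinj : Set.InjOn (fun t => L (g t)) (Set.Icc (-δ) δ) := by
    refine (strictMonoOn_of_deriv_pos (convex_Icc _ _)
      (L.continuous.comp hg.continuous).continuousOn fun t ht => ?_).injOn
    rw [show deriv (L ∘ g) t = L (deriv g t) from (hLg t).deriv]
    exact hpos t (interior_subset ht)
  have hmem : ∀ θ, δ * Real.sin θ ∈ Set.Icc (-δ) δ := fun θ =>
    ⟨by nlinarith [Real.neg_one_le_sin θ], by nlinarith [Real.sin_le_one θ]⟩
  set γ : ℝ → Plane := fun u => g (δ * Real.sin (2 * Real.pi * u)) +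
    (max 0 (1 / 2 - Real.cos (2 * Real.pi * u)) ^ 2) • w with hγ
  have hγd : ∀ u, HasDerivAt γ
      ((δ * (Real.cos (2 * Real.pi * u) * (2 * Real.pi))) •
          deriv g (δ * Real.sin (2 * Real.pi * u)) +
        (2 * max 0 (1 / 2 - Real.cos (2 * Real.pi * u)) *
          (Real.sin (2 * Real.pi * u) * (2 * Real.pi))) • w) u := fun u => by
    have hlin : HasDerivAt (fun u : ℝ => 2 * Real.pi * u) (2 * Real.pi) u := by
      simpa using (hasDerivAt_id u).const_mul (2 * Real.pi)
    have h1 := (hgd (δ * Real.sin (2 * Real.pi * u))).scomp u (hlin.sin.const_mul δ)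
    have h2 := ((hasDerivAt_max_zero_sq (1 / 2 - Real.cos (2 * Real.pi * u))).comp u
      (hlin.cos.const_sub (1 / 2))).smul_const w
    refine (h1.add h2).congr_deriv ?_
    congr 2
    ring
  refine ⟨γ, ⟨?_, ?_, ?_, ?_⟩, ?_, ?_⟩
  · refine ContDiff.add (hg.comp (by fun_prop)) (ContDiff.smul_const ?_ w)
    exact contDiff_max_zero_sq.comp (g := fun y : ℝ => max 0 y ^ 2)
      (f := fun u : ℝ => 1 / 2 - Real.cos (2 * Real.pi * u)) (by fun_prop)
  · intro u
    simp only [hγ, mul_add, mul_one, Real.sin_add_two_pi, Real.cos_add_two_pi]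
  · intro a ha b hb hab
    have hsin : Real.sin (2 * Real.pi * a) = Real.sin (2 * Real.pi * b) := by
      have h := congrArg L hab
      simp only [hγ, map_add, map_smul, hLw, smul_zero, add_zero] at h
      exact mul_left_cancel₀ hδ.ne' (hinj (hmem _) (hmem _) h)
    have hmax : max 0 (1 / 2 - Real.cos (2 * Real.pi * a)) =
        max 0 (1 / 2 - Real.cos (2 * Real.pi * b)) := by
      simp only [hγ, hsin, add_right_inj] at hab
      exact (sq_eq_sq₀ (le_max_left _ _) (le_max_left _ _)).1 (smul_left_injective ℝ hw0 hab)
    have hcos : Real.cos (2 * Real.pi * a) = Real.cos (2 * Real.pi * b) := by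
      have hsq : Real.cos (2 * Real.pi * a) ^ 2 = Real.cos (2 * Real.pi * b) ^ 2 := by
        rw [Real.cos_sq', Real.cos_sq', hsin]
      rcases sq_eq_sq_iff_eq_or_eq_neg.1 hsq with h | h
      · exact h
      · rw [h] at hmax ⊢
        rcases max_cases 0 (1 / 2 - -Real.cos (2 * Real.pi * b)) with h1 | h1 <;>
        rcases max_cases 0 (1 / 2 - Real.cos (2 * Real.pi * b)) with h2 | h2 <;>
        linarith [h1.1, h1.2, h2.1, h2.2]
    obtain ⟨k, hk⟩ := Real.Angle.angle_eq_iff_two_pi_dvd_sub.1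
      (Real.Angle.cos_sin_inj hcos hsin)
    have hk' : a - b = k := by
      have : 2 * Real.pi * (a - b) = 2 * Real.pi * k := by linarith
      exact mul_left_cancel₀ Real.two_pi_pos.ne' this
    have h1 : (k : ℝ) < 1 := by linarith [ha.2, hb.1]
    have h2 : (-1 : ℝ) < k := by linarith [ha.1, hb.2]
    have hk0 : k = 0 := by
      have h1' : k < 1 := by exact_mod_cast h1
      have h2' : -1 < k := by exact_mod_cast h2
      omega
    rw [hk0, Int.cast_zero] at hk'
    linarith
  · intro u hu
    rw [(hγd u).deriv] at hu
    have hcos : Real.cos (2 * Real.pi * u) = 0 := by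
      have h := congrArg L hu
      simpa [hLw, hδ.ne', (hpos _ (hmem _)).ne', Real.pi_ne_zero] using h
    have hsin : Real.sin (2 * Real.pi * u) ≠ 0 := fun h => by
      have := Real.sin_sq_add_cos_sq (2 * Real.pi * u)
      simp [h, hcos] at this
    rw [hcos] at hu
    simp [hsin, hw0, Real.pi_ne_zero] at hu
  · norm_num [hγ]
  · have hev : ∀ᶠ t in 𝓝 (0 : ℝ), t ∈ Set.Ioo (-(δ / 2)) (δ / 2) :=
      Ioo_mem_nhds (by linarith) (by linarith)
    filter_upwards [hev] with t ht
    have h1 : t / δ < 1 / 2 := by rw [div_lt_iff₀ hδ]; linarith [ht.2]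
    have h2 : -(1 / 2) < t / δ := by rw [lt_div_iff₀ hδ]; linarith [ht.1]
    refine ⟨Real.arcsin (t / δ) / (2 * Real.pi), ?_⟩
    have hθ : 2 * Real.pi * (Real.arcsin (t / δ) / (2 * Real.pi)) = Real.arcsin (t / δ) :=
      mul_div_cancel₀ _ Real.two_pi_pos.ne'
    have hcos : 1 / 2 ≤ Real.cos (Real.arcsin (t / δ)) := by
      rw [Real.cos_arcsin]
      exact Real.le_sqrt_of_sq_le (by nlinarith)
    simp only [hγ, hθ, Real.sin_arcsin (by linarith : -1 ≤ t / δ) (by linarith),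
      mul_div_cancel₀ t hδ.ne', max_eq_left (sub_nonpos.2 hcos)]
    simp

theorem tendsto_exp_sub_two_pi_mul (c : ℝ) :
    Tendsto (fun n : ℕ => Real.exp (c - n * (2 * Real.pi))) atTop (𝓝[≠] 0) := by
  refine tendsto_nhdsWithin_iff.2 ⟨Real.tendsto_exp_atBot.comp ?_,
    Eventually.of_forall fun n => (Real.exp_pos _).ne'⟩
  exact tendsto_atBot_add_const_left _ c (tendsto_neg_atTop_atBot.comp
    (tendsto_natCast_atTop_atTop.atTop_mul_const Real.two_pi_pos)) |>.congr fun n => by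
      simp [sub_eq_add_neg]

/-- Two C¹ arcs with the same velocity at a common point admit a simple closed C¹ curve meeting
each of them along a sequence accumulating at that point. -/
theorem exists_regParam_meeting_both {c₁ c₂ : ℝ → Plane} (h₁ : ContDiff ℝ 1 c₁)
    (h₂ : ContDiff ℝ 1 c₂) (h0 : c₁ 0 = c₂ 0) (hd : deriv c₁ 0 = deriv c₂ 0)
    (hv : deriv c₁ 0 ≠ 0) :
    ∃ γ : ℝ → Plane, IsRegParam γ ∧ γ 0 = c₁ 0 ∧
      ∀ c ∈ ({c₁, c₂} : Set (ℝ → Plane)), ∃ x : ℕ → Plane, Tendsto x atTop (𝓝 (c₁ 0)) ∧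
        (∀ n, x n ≠ c₁ 0) ∧ (∀ n, x n ∈ Set.range γ) ∧ ∀ n, x n ∈ Set.range c := by
  have hd₁ := (h₁.differentiable one_ne_zero 0).hasDerivAt
  have hd₂ := (h₂.differentiable one_ne_zero 0).hasDerivAt
  obtain ⟨hC, hD⟩ := contDiff_and_hasDerivAt_oscillation (d := fun t => c₂ t - c₁ t) (h₂.sub h₁)
    (by simp [h0]) (by rw [(hd₂.fun_sub hd₁).deriv, hd, sub_self])
  set g : ℝ → Plane := fun t => c₁ t + ((1 + Real.sin (Real.log t)) / 2) • (c₂ t - c₁ t) with hg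
  have hg0 : g 0 = c₁ 0 := by simp [hg, h0]
  have hgd : HasDerivAt g (deriv c₁ 0) 0 := by simpa using hd₁.fun_add hD
  obtain ⟨γ, hγ, hγ0, hev⟩ := exists_regParam_through_germ (h₁.add hC) (by rwa [hgd.deriv])
  refine ⟨γ, hγ, hγ0.trans hg0, ?_⟩
  have key : ∀ c : ℝ → Plane, ∀ a : ℝ,
      (∀ n : ℕ, g (Real.exp (a - n * (2 * Real.pi))) = c (Real.exp (a - n * (2 * Real.pi)))) →
      ∃ x : ℕ → Plane, Tendsto x atTop (𝓝 (c₁ 0)) ∧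
        (∀ n, x n ≠ c₁ 0) ∧ (∀ n, x n ∈ Set.range γ) ∧ ∀ n, x n ∈ Set.range c := by
    intro c a hca
    have ht := tendsto_exp_sub_two_pi_mul a
    have hall := ht.eventually ((hgd.eventually_ne hv (c := c₁ 0)).and
      (hev.filter_mono nhdsWithin_le_nhds))
    obtain ⟨N, hN⟩ := eventually_atTop.1 hall
    refine ⟨fun n => g (Real.exp (a - (n + N : ℕ) * (2 * Real.pi))), ?_,
      fun n => (hN _ (Nat.le_add_left N n)).1, fun n => (hN _ (Nat.le_add_left N n)).2,
      fun n => ⟨_, (hca _).symm⟩⟩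
    have hgc : Tendsto g (𝓝 0) (𝓝 (c₁ 0)) := hg0 ▸ hgd.continuousAt.tendsto
    exact (tendsto_add_atTop_iff_nat (f := fun n : ℕ => g (Real.exp (a - n * (2 * Real.pi)))) N).2
      (hgc.comp (ht.mono_right nhdsWithin_le_nhds))
  rintro c (rfl | rfl)
  · refine key c (-(Real.pi / 2)) fun n => ?_
    simp [hg, Real.log_exp, Real.sin_sub_nat_mul_two_pi]
  · refine key c (Real.pi / 2) fun n => ?_
    simp [hg, Real.log_exp, Real.sin_sub_nat_mul_two_pi]

/-- If a C¹-preserving homeomorphism is applied to two curves meeting along a sequence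
accumulating at `p`, the images are tangent at the image of `p`. -/
theorem TangentAt.image_of_accumulation {f : Plane ≃ₜ Plane} (hf : MapsC1 f) {A Γ : Set Plane}
    {p : Plane} {ℓ' : ProjLine} (hA : IsC1Curve A) (hp : p ∈ A)
    (hΓ : TangentAt (f '' Γ) (f p) ℓ') {x : ℕ → Plane} (hx : Tendsto x atTop (𝓝 p))
    (hne : ∀ n, x n ≠ p) (hxA : ∀ n, x n ∈ A) (hxΓ : ∀ n, x n ∈ Γ) :
    TangentAt (f '' A) (f p) ℓ' := by
  obtain ⟨γ, hγ, hr⟩ := hf A hA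
  obtain ⟨η, s, hη, hηr, hηs, rfl⟩ := hΓ
  obtain ⟨t, ht⟩ : f p ∈ Set.range γ := hr ▸ Set.mem_image_of_mem f hp
  refine ⟨γ, t, hγ, hr, ht, (hγ.mk_deriv_eq hη ht hηs (x := fun n => f (x n))
    ((f.continuous.tendsto p).comp hx) (fun n h => hne n (f.injective h))
    (fun n => hr ▸ Set.mem_image_of_mem f (hxA n))
    (fun n => hηr ▸ Set.mem_image_of_mem f (hxΓ n))).symm⟩

/-- If `f ∈ Homeo¹(ℝ²)` and the simple closed C¹ curves `α` and `β` have the same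
tangent line at a common point `p`, then `f(α)` and `f(β)` have the same tangent
line at `f(p)`. -/
theorem image_curves_same_tangent (f : Plane ≃ₜ Plane) (hf : InHomeo1 f)
    (α β : Set Plane) (hα : IsC1Curve α) (hβ : IsC1Curve β)
    (p : Plane) (hp : p ∈ α ∩ β) (ℓ : ProjLine)
    (hαt : TangentAt α p ℓ) (hβt : TangentAt β p ℓ) :
    ∃ ℓ' : ProjLine, TangentAt (⇑f '' α) (f p) ℓ' ∧ TangentAt (⇑f '' β) (f p) ℓ' := by
  obtain ⟨γ₁, t₁, h₁, hα', hp₁, hℓ₁⟩ := hαt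
  obtain ⟨γ₂, t₂, h₂, hβ', hp₂, hℓ₂⟩ := hβt
  obtain ⟨a, ha⟩ := (Projectivization.mk_eq_mk_iff' ℝ _ _ _ _).1 (hℓ₁.symm.trans hℓ₂)
  have hd₁ : HasDerivAt (fun t => γ₁ (t₁ + t)) (deriv γ₁ t₁) 0 :=
    HasDerivAt.comp_const_add t₁ 0 (by simpa using h₁.hasDerivAt t₁)
  have hd₂ : HasDerivAt (fun t => γ₂ (t₂ + a * t)) (deriv γ₁ t₁) 0 := by
    have hlin : HasDerivAt (fun t : ℝ => t₂ + a * t) a 0 := by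
      simpa using ((hasDerivAt_id (0 : ℝ)).const_mul a).const_add t₂
    have h := HasDerivAt.scomp (0 : ℝ) (h := fun t : ℝ => t₂ + a * t) (h₂.hasDerivAt _) hlin
    simpa [Function.comp_def, ha] using h
  obtain ⟨γ, hγ, hγ0, hmeet⟩ := exists_regParam_meeting_both
    (c₁ := fun t => γ₁ (t₁ + t)) (c₂ := fun t => γ₂ (t₂ + a * t))
    (h₁.1.comp (by fun_prop)) (h₂.1.comp (by fun_prop)) (by simp [hp₁, hp₂])
    (by rw [hd₁.deriv, hd₂.deriv]) (by rw [hd₁.deriv]; exact h₁.2.2.2 t₁)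
  simp only [add_zero, hp₁] at hγ0 hmeet
  obtain ⟨η, hη, hηr⟩ := hf.1 (Set.range γ) ⟨γ, hγ, rfl⟩
  obtain ⟨s, hs⟩ : f p ∈ Set.range η := hηr ▸ Set.mem_image_of_mem f ⟨0, hγ0⟩
  have hΓ : TangentAt (f '' Set.range γ) (f p) (Projectivization.mk ℝ (deriv η s) (hη.2.2.2 s)) :=
    ⟨η, s, hη, hηr, hs, rfl⟩
  refine ⟨Projectivization.mk ℝ (deriv η s) (hη.2.2.2 s), ?_, ?_⟩
  · obtain ⟨x, hx, hne, hxγ, hxc⟩ := hmeet _ (Or.inl rfl)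
    refine TangentAt.image_of_accumulation hf.1 hα hp.1 hΓ hx hne (fun n => ?_) hxγ
    obtain ⟨t, ht⟩ := hxc n
    exact hα' ▸ ⟨_, ht⟩
  · obtain ⟨x, hx, hne, hxγ, hxc⟩ := hmeet _ (Or.inr rfl)
    refine TangentAt.image_of_accumulation hf.1 hβ hp.2 hΓ hx hne (fun n => ?_) hxγ
    obtain ⟨t, ht⟩ := hxc n
    exact hβ' ▸ ⟨_, ht⟩
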